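/- arXiv:2211.10757 — 3 statements merged into one kernel-verified Lean document; each statement's English description precedes it below -/
import Mathlib

section
/- Fix r₀ > 0, ε > 0, and a nonzero integer m, and let Ψ_ε = (1/2)[(r−r₀)² + z²] + (1/2) ε sin(mφ) on the open set where r > 0 and (r−r₀)² + z² > 0. Let α = arctan(z/(r−r₀)) (a local poloidal angle, whose gradient ∇α = [(r−r₀)∇z − z∇r]/[(r−r₀)²+z²] is a globally defined smooth vector field on this set), and let f : ℝ → ℝ be continuously differentiable. Then the vector field w = f(Ψ_ε)∇α satisfies (∇×w)×w = −(1/2)(d(f²)/dΨ_ε)(Ψ_ε) |∇α|² ∇Ψ_ε = −(1/(2[2Ψ_ε − ε sin(mφ)])) (d(f²)/dΨ_ε)(Ψ_ε) ∇Ψ_ε, hence [(∇×w)×w]×∇Ψ_ε = 0, while ∇·w = −z f(Ψ_ε)/(r[2Ψ_ε − ε sin(mφ)]), which is not identically zero when f is not identically zero. -/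
/-- Partial derivative of a scalar field on `ℝ³` in the `i`-th coordinate direction. -/
noncomputable def pd (i : Fin 3) (f : (Fin 3 → ℝ) → ℝ) (x : Fin 3 → ℝ) : ℝ :=
  fderiv ℝ f x (Pi.single i 1)

/-- Gradient of a scalar field on `ℝ³`. -/
noncomputable def grad (f : (Fin 3 → ℝ) → ℝ) (x : Fin 3 → ℝ) : Fin 3 → ℝ :=
  ![pd 0 f x, pd 1 f x, pd 2 f x]

/-- Divergence of a vector field on `ℝ³`. -/
noncomputable def div3 (w : (Fin 3 → ℝ) → (Fin 3 → ℝ)) (x : Fin 3 → ℝ) : ℝ :=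
  pd 0 (fun y => w y 0) x + pd 1 (fun y => w y 1) x + pd 2 (fun y => w y 2) x

/-- Curl of a vector field on `ℝ³`. -/
noncomputable def curl (w : (Fin 3 → ℝ) → (Fin 3 → ℝ)) (x : Fin 3 → ℝ) : Fin 3 → ℝ :=
  ![pd 1 (fun y => w y 2) x - pd 2 (fun y => w y 1) x,
    pd 2 (fun y => w y 0) x - pd 0 (fun y => w y 2) x,
    pd 0 (fun y => w y 1) x - pd 1 (fun y => w y 0) x]

/-- Cross product on `ℝ³`. -/
def cross3 (u v : Fin 3 → ℝ) : Fin 3 → ℝ :=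
  ![u 1 * v 2 - u 2 * v 1, u 2 * v 0 - u 0 * v 2, u 0 * v 1 - u 1 * v 0]

/-- Dot product on `ℝ³`. -/
def dot3 (u v : Fin 3 → ℝ) : ℝ := u 0 * v 0 + u 1 * v 1 + u 2 * v 2

open scoped Real

/-- The cylindrical radius `r = √(x² + y²)`. -/
noncomputable def cylR (p : Fin 3 → ℝ) : ℝ := Real.sqrt (p 0 ^ 2 + p 1 ^ 2)

/-- The azimuthal angle `φ` of a point of `ℝ³`. -/
noncomputable def cylφ (p : Fin 3 → ℝ) : ℝ := Complex.arg ((p 0 : ℂ) + (p 1 : ℂ) * Complex.I)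

theorem HasFDerivAt.pd_eq {i : Fin 3} {f : (Fin 3 → ℝ) → ℝ} {f' : (Fin 3 → ℝ) →L[ℝ] ℝ}
    {p : Fin 3 → ℝ} (h : HasFDerivAt f f' p) : pd i f p = f' (Pi.single i 1) := by
  rw [pd, h.fderiv]

theorem pd_mul {i : Fin 3} {f g : (Fin 3 → ℝ) → ℝ} {p : Fin 3 → ℝ}
    (hf : DifferentiableAt ℝ f p) (hg : DifferentiableAt ℝ g p) :
    pd i (fun y => f y * g y) p = f p * pd i g p + pd i f p * g p := by
  rw [(hf.hasFDerivAt.fun_mul hg.hasFDerivAt).pd_eq]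
  simp [pd, mul_comm]

theorem curl_smul {h : (Fin 3 → ℝ) → ℝ} {A : (Fin 3 → ℝ) → (Fin 3 → ℝ)} {p : Fin 3 → ℝ}
    (hh : DifferentiableAt ℝ h p) (hA : ∀ i, DifferentiableAt ℝ (fun y => A y i) p) :
    curl (fun y => h y • A y) p = h p • curl A p + cross3 (grad h p) (A p) := by
  ext i
  fin_cases i <;> simp [curl, cross3, grad, pd_mul hh (hA _)] <;> ring

theorem div3_smul {h : (Fin 3 → ℝ) → ℝ} {A : (Fin 3 → ℝ) → (Fin 3 → ℝ)} {p : Fin 3 → ℝ}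
    (hh : DifferentiableAt ℝ h p) (hA : ∀ i, DifferentiableAt ℝ (fun y => A y i) p) :
    div3 (fun y => h y • A y) p = h p * div3 A p + dot3 (grad h p) (A p) := by
  simp [div3, dot3, grad, pd_mul hh (hA _)]
  ring

theorem grad_comp {f : ℝ → ℝ} {h : (Fin 3 → ℝ) → ℝ} {p : Fin 3 → ℝ}
    (hf : DifferentiableAt ℝ f (h p)) (hh : DifferentiableAt ℝ h p) :
    grad (fun y => f (h y)) p = deriv f (h p) • grad h p := by
  have key (i : Fin 3) : pd i (fun y => f (h y)) p = deriv f (h p) * pd i h p := by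
    have := hf.hasDerivAt.comp_hasFDerivAt p hh.hasFDerivAt
    exact this.pd_eq.trans (by simp [pd])
  ext i
  fin_cases i <;> simp [grad, key]

theorem cross3_cross3_right_self {u v : Fin 3 → ℝ} (huv : dot3 u v = 0) :
    cross3 (cross3 u v) v = -(dot3 v v) • u := by
  simp only [dot3] at huv
  ext i
  fin_cases i <;> simp [cross3, dot3]
  · linear_combination v 0 * huv
  · linear_combination v 1 * huv
  · linear_combination v 2 * huv

theorem cross3_smul_self (c : ℝ) (u : Fin 3 → ℝ) : cross3 (c • u) u = 0 := by
  ext i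
  fin_cases i <;> simp [cross3] <;> ring

theorem hasFDerivAt_coord (i : Fin 3) (p : Fin 3 → ℝ) :
    HasFDerivAt (fun q : Fin 3 → ℝ => q i)
      (ContinuousLinearMap.proj i : (Fin 3 → ℝ) →L[ℝ] ℝ) p :=
  hasFDerivAt_apply i p

theorem sq_cylR (p : Fin 3 → ℝ) : cylR p ^ 2 = p 0 ^ 2 + p 1 ^ 2 :=
  Real.sq_sqrt (by positivity)

theorem hasFDerivAt_cylR {p : Fin 3 → ℝ} (hp : 0 < cylR p) :
    HasFDerivAt cylR ((p 0 / cylR p) • ContinuousLinearMap.proj 0 +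
      (p 1 / cylR p) • ContinuousLinearMap.proj 1 : (Fin 3 → ℝ) →L[ℝ] ℝ) p := by
  have h0 : p 0 ^ 2 + p 1 ^ 2 ≠ 0 := by rw [← sq_cylR]; positivity
  refine ((((hasFDerivAt_coord 0 p).pow 2).add ((hasFDerivAt_coord 1 p).pow 2)).sqrt h0).congr_fderiv
    ?_
  ext v
  have : √(p 0 ^ 2 + p 1 ^ 2) = cylR p := rfl
  simp [this]
  field_simp

/-- The planar projection of a point of `ℝ³`, as a complex number. -/
noncomputable def planarC : (Fin 3 → ℝ) →L[ℝ] ℂ :=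
  Complex.ofRealCLM.comp (ContinuousLinearMap.proj 0) +
    (Complex.ofRealCLM.comp (ContinuousLinearMap.proj 1)).smulRight Complex.I

theorem planarC_apply (p : Fin 3 → ℝ) : planarC p = (p 0 : ℂ) + (p 1 : ℂ) * Complex.I := by
  simp [planarC]

theorem hasFDerivAt_arg {u : ℂ} (hu : u ∈ Complex.slitPlane) :
    HasFDerivAt Complex.arg ((u.re / Complex.normSq u) • Complex.imCLM
      - (u.im / Complex.normSq u) • Complex.reCLM : ℂ →L[ℝ] ℝ) u := by
  have h1 := Complex.imCLM.hasFDerivAt.comp u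
    ((Complex.hasStrictDerivAt_log hu).hasDerivAt.hasFDerivAt.restrictScalars ℝ)
  have h2 : (Complex.imCLM ∘ Complex.log) = Complex.arg := by
    ext z; simp [Complex.log_im]
  rw [h2] at h1
  refine h1.congr_fderiv ?_
  ext
  all_goals simp
  ring

theorem Real.sin_int_mul_arg_neg (m : ℤ) {u : ℂ} (hu : u ≠ 0) :
    Real.sin (m * Complex.arg u) = (-1) ^ m * Real.sin (m * Complex.arg (-u)) := by
  have h : Complex.arg u = Complex.arg (-u) + π ∨ Complex.arg u = Complex.arg (-u) - π := by
    rcases lt_trichotomy u.im 0 with hi | hi | hi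
    · right; rw [Complex.arg_neg_eq_arg_add_pi_of_im_neg hi]; ring
    · rcases lt_trichotomy u.re 0 with hr | hr | hr
      · left; rw [Complex.arg_neg_eq_arg_sub_pi_iff.2 (.inr ⟨hi, hr⟩)]; ring
      · exact absurd (Complex.ext hr hi) hu
      · right; rw [Complex.arg_neg_eq_arg_add_pi_iff.2 (.inr ⟨hi, hr⟩)]; ring
    · left; rw [Complex.arg_neg_eq_arg_sub_pi_of_im_pos hi]; ring
  rcases h with h | h <;> rw [h]
  · rw [mul_add, Real.sin_add_int_mul_pi]
  · rw [mul_sub, Real.sin_sub_int_mul_pi]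

theorem exists_hasFDerivAt_sin_mul_cylφ (m : ℤ) {p : Fin 3 → ℝ} (hp : 0 < cylR p) :
    ∃ c : ℝ, HasFDerivAt (fun q => Real.sin (m * cylφ q))
      (c • (p 0 • ContinuousLinearMap.proj 1 - p 1 • ContinuousLinearMap.proj 0) :
        (Fin 3 → ℝ) →L[ℝ] ℝ) p := by
  have h0 : planarC p ≠ 0 := by
    intro h
    have hre := congrArg Complex.re h
    have him := congrArg Complex.im h
    simp [planarC_apply] at hre him
    simp [cylR, hre, him] at hp
  have hcyl : ∀ q, cylφ q = Complex.arg (planarC q) := fun q => by rw [planarC_apply, cylφ]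
  by_cases hs : planarC p ∈ Complex.slitPlane
  · have h1 := (((hasFDerivAt_arg hs).comp p planarC.hasFDerivAt).const_mul (m : ℝ)).sin
    refine ⟨Real.cos (m * cylφ p) * m / Complex.normSq (planarC p), ?_⟩
    simp only [hcyl]
    refine h1.congr_fderiv ?_
    ext v
    simp [planarC_apply]
    ring
  · have hs' : -planarC p ∈ Complex.slitPlane :=
      (Complex.mem_slitPlane_or_neg_mem_slitPlane h0).resolve_left hs
    have h1 := ((((hasFDerivAt_arg hs').comp p
      planarC.hasFDerivAt.neg).const_mul (m : ℝ)).sin).const_mul ((-1) ^ m)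
    refine ⟨(-1) ^ m * Real.cos (m * Complex.arg (-planarC p)) * m /
      Complex.normSq (planarC p), ?_⟩
    refine (h1.congr_fderiv ?_).congr_of_eventuallyEq ?_
    · ext v
      simp [-neg_add_rev, planarC_apply]
      ring
    · filter_upwards [planarC.continuous.continuousAt.eventually_ne h0] with q hq
      simp [hcyl, Real.sin_int_mul_arg_neg m hq]

/-- The gradient of the poloidal angle around the circle `r = r₀`, `z = 0`. -/
noncomputable def gradPoloidal (r₀ : ℝ) (p : Fin 3 → ℝ) : Fin 3 → ℝ :=
  ((cylR p - r₀) ^ 2 + p 2 ^ 2)⁻¹ •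
    ![-(p 2) * p 0 / cylR p, -(p 2) * p 1 / cylR p, cylR p - r₀]

section Poloidal

variable {r₀ : ℝ} {p : Fin 3 → ℝ}

theorem hasFDerivAt_gradPoloidal_horizontal (i : Fin 3) (hr : 0 < cylR p)
    (hρ : 0 < (cylR p - r₀) ^ 2 + p 2 ^ 2) :
    HasFDerivAt (fun q : Fin 3 → ℝ => ((cylR q - r₀) ^ 2 + q 2 ^ 2)⁻¹ * (-(q 2) * q i / cylR q))
      (((cylR p - r₀) ^ 2 + p 2 ^ 2)⁻¹ • ((-(p i) / cylR p) • ContinuousLinearMap.proj 2 +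
        (-(p 2) / cylR p) • ContinuousLinearMap.proj i +
        (p 2 * p i / cylR p ^ 3) • (p 0 • ContinuousLinearMap.proj 0 +
          p 1 • ContinuousLinearMap.proj 1)) +
      (2 * p 2 * p i / cylR p / ((cylR p - r₀) ^ 2 + p 2 ^ 2) ^ 2) •
        (((cylR p - r₀) / cylR p) • (p 0 • ContinuousLinearMap.proj 0 +
          p 1 • ContinuousLinearMap.proj 1) + p 2 • ContinuousLinearMap.proj 2) :
        (Fin 3 → ℝ) →L[ℝ] ℝ) p := by
  have hR := hasFDerivAt_cylR hr
  have h1 := (hasDerivAt_inv hρ.ne').comp_hasFDerivAt p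
    (((hR.sub_const r₀).pow 2).add ((hasFDerivAt_coord 2 p).pow 2))
  have h2 := ((hasFDerivAt_coord 2 p).neg.mul (hasFDerivAt_coord i p)).mul
    ((hasDerivAt_inv hr.ne').comp_hasFDerivAt p hR)
  refine ((h1.mul h2).congr_fderiv ?_).congr_of_eventuallyEq
    (.of_forall fun q => by simp [div_eq_mul_inv])
  ext v
  simp
  field_simp
  ring

theorem hasFDerivAt_gradPoloidal_vertical (hr : 0 < cylR p)
    (hρ : 0 < (cylR p - r₀) ^ 2 + p 2 ^ 2) :
    HasFDerivAt (fun q : Fin 3 → ℝ => ((cylR q - r₀) ^ 2 + q 2 ^ 2)⁻¹ * (cylR q - r₀))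
      ((((cylR p - r₀) ^ 2 + p 2 ^ 2)⁻¹ / cylR p) • (p 0 • ContinuousLinearMap.proj 0 +
          p 1 • ContinuousLinearMap.proj 1) -
      (2 * (cylR p - r₀) / ((cylR p - r₀) ^ 2 + p 2 ^ 2) ^ 2) •
        (((cylR p - r₀) / cylR p) • (p 0 • ContinuousLinearMap.proj 0 +
          p 1 • ContinuousLinearMap.proj 1) + p 2 • ContinuousLinearMap.proj 2) :
        (Fin 3 → ℝ) →L[ℝ] ℝ) p := by
  have hR := (hasFDerivAt_cylR hr).sub_const r₀
  have h1 := (hasDerivAt_inv hρ.ne').comp_hasFDerivAt p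
    ((hR.pow 2).add ((hasFDerivAt_coord 2 p).pow 2))
  refine (h1.mul hR).congr_fderiv ?_
  ext v
  simp
  field_simp
  ring

theorem differentiableAt_gradPoloidal (hr : 0 < cylR p)
    (hρ : 0 < (cylR p - r₀) ^ 2 + p 2 ^ 2) (i : Fin 3) :
    DifferentiableAt ℝ (fun q => gradPoloidal r₀ q i) p := by
  fin_cases i
  · exact (hasFDerivAt_gradPoloidal_horizontal 0 hr hρ).differentiableAt
  · exact (hasFDerivAt_gradPoloidal_horizontal 1 hr hρ).differentiableAt
  · exact (hasFDerivAt_gradPoloidal_vertical hr hρ).differentiableAt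

theorem curl_gradPoloidal (hr : 0 < cylR p) (hρ : 0 < (cylR p - r₀) ^ 2 + p 2 ^ 2) :
    curl (gradPoloidal r₀) p = 0 := by
  have h0 (i : Fin 3) : pd i (fun q => gradPoloidal r₀ q 0) p = _ :=
    (hasFDerivAt_gradPoloidal_horizontal 0 hr hρ).pd_eq
  have h1 (i : Fin 3) : pd i (fun q => gradPoloidal r₀ q 1) p = _ :=
    (hasFDerivAt_gradPoloidal_horizontal 1 hr hρ).pd_eq
  have h2 (i : Fin 3) : pd i (fun q => gradPoloidal r₀ q 2) p = _ :=
    (hasFDerivAt_gradPoloidal_vertical hr hρ).pd_eq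
  ext i
  fin_cases i <;> simp [curl, h0, h1, h2] <;> field_simp <;> ring

theorem div3_gradPoloidal (hr : 0 < cylR p) (hρ : 0 < (cylR p - r₀) ^ 2 + p 2 ^ 2) :
    div3 (gradPoloidal r₀) p = -(p 2) / (cylR p * ((cylR p - r₀) ^ 2 + p 2 ^ 2)) := by
  have h0 : pd 0 (fun q => gradPoloidal r₀ q 0) p = _ :=
    (hasFDerivAt_gradPoloidal_horizontal 0 hr hρ).pd_eq
  have h1 : pd 1 (fun q => gradPoloidal r₀ q 1) p = _ :=
    (hasFDerivAt_gradPoloidal_horizontal 1 hr hρ).pd_eq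
  have h2 : pd 2 (fun q => gradPoloidal r₀ q 2) p = _ :=
    (hasFDerivAt_gradPoloidal_vertical hr hρ).pd_eq
  have hsq : p 1 ^ 2 = cylR p ^ 2 - p 0 ^ 2 := by rw [sq_cylR]; ring
  simp [div3, h0, h1, h2]
  field_simp
  ring_nf
  simp only [hsq]
  ring

theorem dot3_gradPoloidal_self (hr : 0 < cylR p) (hρ : 0 < (cylR p - r₀) ^ 2 + p 2 ^ 2) :
    dot3 (gradPoloidal r₀ p) (gradPoloidal r₀ p) = ((cylR p - r₀) ^ 2 + p 2 ^ 2)⁻¹ := by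
  have hsq : p 1 ^ 2 = cylR p ^ 2 - p 0 ^ 2 := by rw [sq_cylR]; ring
  simp [dot3, gradPoloidal]
  field_simp
  simp only [hsq]
  ring

end Poloidal

/-- with `Ψ_ε = (1/2)[(r−r₀)² + z²] + (1/2) ε sin(mφ)` and the (global, smooth)
poloidal-angle gradient `∇α = [(r−r₀)∇z − z∇r]/[(r−r₀)² + z²]`, the field `w = f(Ψ_ε)∇α`
satisfies `(∇×w)×w = −(1/2)(f²)'(Ψ_ε)|∇α|²∇Ψ_ε = −(1/(2[2Ψ_ε − ε sin(mφ)]))(f²)'(Ψ_ε)∇Ψ_ε`,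
hence `[(∇×w)×w]×∇Ψ_ε = 0`, while `∇·w = −z f(Ψ_ε)/(r[2Ψ_ε − ε sin(mφ)])`, which is not
identically zero when `f` is not identically zero there. -/
theorem nonsolenoidal_foliated_example
    (r₀ ε : ℝ) (hr₀ : 0 < r₀) (hε : 0 < ε) (m : ℤ) (hm : m ≠ 0)
    (f : ℝ → ℝ) (hf : ContDiff ℝ 1 f)
    (Ψ : (Fin 3 → ℝ) → ℝ)
    (hΨ : ∀ p : Fin 3 → ℝ, Ψ p =
      (1/2) * ((cylR p - r₀) ^ 2 + p 2 ^ 2) + (1/2) * ε * Real.sin ((m : ℝ) * cylφ p))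
    (A : (Fin 3 → ℝ) → (Fin 3 → ℝ))
    (hA : ∀ p : Fin 3 → ℝ, A p = ((cylR p - r₀) ^ 2 + p 2 ^ 2)⁻¹ •
      ![-(p 2) * p 0 / cylR p, -(p 2) * p 1 / cylR p, cylR p - r₀])
    (w : (Fin 3 → ℝ) → (Fin 3 → ℝ)) (hw : ∀ p, w p = f (Ψ p) • A p)
    (S : Set (Fin 3 → ℝ))
    (hS : S = {p : Fin 3 → ℝ | 0 < cylR p ∧ 0 < (cylR p - r₀) ^ 2 + p 2 ^ 2}) :
    (∀ p ∈ S, cross3 (curl w p) (w p) =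
      (-(1/2) * deriv (fun t => f t ^ 2) (Ψ p) * dot3 (A p) (A p)) • grad Ψ p) ∧
    (∀ p ∈ S, cross3 (curl w p) (w p) =
      (-(1 / (2 * (2 * Ψ p - ε * Real.sin ((m : ℝ) * cylφ p)))) *
        deriv (fun t => f t ^ 2) (Ψ p)) • grad Ψ p) ∧
    (∀ p ∈ S, cross3 (cross3 (curl w p) (w p)) (grad Ψ p) = 0) ∧
    (∀ p ∈ S, div3 w p =
      -(p 2) * f (Ψ p) / (cylR p * (2 * Ψ p - ε * Real.sin ((m : ℝ) * cylφ p)))) ∧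
    ((∃ p ∈ S, f (Ψ p) ≠ 0) → ¬ ∀ p ∈ S, div3 w p = 0) := by
  obtain rfl : A = gradPoloidal r₀ := funext hA
  obtain rfl : w = fun p => f (Ψ p) • gradPoloidal r₀ p := funext hw
  subst hS
  have hfd : Differentiable ℝ f := hf.differentiable (by norm_num)
  have hden (p : Fin 3 → ℝ) :
      2 * Ψ p - ε * Real.sin ((m : ℝ) * cylφ p) = (cylR p - r₀) ^ 2 + p 2 ^ 2 := by
    rw [hΨ]; ring
  have hΨd {p : Fin 3 → ℝ} (hr : 0 < cylR p) :
      DifferentiableAt ℝ Ψ p ∧ dot3 (grad Ψ p) (gradPoloidal r₀ p) = 0 := by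
    obtain ⟨c, hc⟩ := exists_hasFDerivAt_sin_mul_cylφ m hr
    have h := ((((hasFDerivAt_cylR hr).sub_const r₀).pow 2).add
      ((hasFDerivAt_coord 2 p).pow 2)).const_mul (1 / 2) |>.add (hc.const_mul (1 / 2 * ε))
    have hΨ' := h.congr_of_eventuallyEq (.of_forall hΨ)
    refine ⟨hΨ'.differentiableAt, ?_⟩
    have hg (i : Fin 3) := hΨ'.pd_eq (i := i)
    have hsq : p 1 ^ 2 = cylR p ^ 2 - p 0 ^ 2 := by rw [sq_cylR]; ring
    simp [dot3, grad, gradPoloidal, hg]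
    field_simp
    ring_nf
    simp only [hsq]
    ring
  have hfΨ {p : Fin 3 → ℝ} (hd : DifferentiableAt ℝ Ψ p) :
      DifferentiableAt ℝ (fun q => f (Ψ q)) p := (hfd _).comp p hd
  have hdiv : ∀ p ∈ {p : Fin 3 → ℝ | 0 < cylR p ∧ 0 < (cylR p - r₀) ^ 2 + p 2 ^ 2},
      div3 (fun p => f (Ψ p) • gradPoloidal r₀ p) p =
        -(p 2) * f (Ψ p) / (cylR p * (2 * Ψ p - ε * Real.sin ((m : ℝ) * cylφ p))) := by
    rintro p ⟨hr, hρ⟩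
    obtain ⟨hd, h0⟩ := hΨd hr
    rw [hden, div3_smul (hfΨ hd) (differentiableAt_gradPoloidal hr hρ),
      grad_comp (hfd _) hd, div3_gradPoloidal hr hρ]
    have : dot3 (deriv f (Ψ p) • grad Ψ p) (gradPoloidal r₀ p) =
        deriv f (Ψ p) * dot3 (grad Ψ p) (gradPoloidal r₀ p) := by
      simp [dot3]; ring
    rw [this, h0]
    ring
  have hcross : ∀ p ∈ {p : Fin 3 → ℝ | 0 < cylR p ∧ 0 < (cylR p - r₀) ^ 2 + p 2 ^ 2},
      cross3 (curl (fun p => f (Ψ p) • gradPoloidal r₀ p) p) (f (Ψ p) • gradPoloidal r₀ p) =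
        (-(1/2) * deriv (fun t => f t ^ 2) (Ψ p) *
          dot3 (gradPoloidal r₀ p) (gradPoloidal r₀ p)) • grad Ψ p := by
    rintro p ⟨hr, hρ⟩
    obtain ⟨hd, h0⟩ := hΨd hr
    have hsq : deriv (fun t => f t ^ 2) (Ψ p) = 2 * f (Ψ p) * deriv f (Ψ p) := by
      simpa using ((hfd (Ψ p)).hasDerivAt.fun_pow 2).deriv
    rw [curl_smul (hfΨ hd) (differentiableAt_gradPoloidal hr hρ),
      grad_comp (hfd _) hd, curl_gradPoloidal hr hρ, smul_zero, zero_add, hsq]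
    have : cross3 (cross3 (deriv f (Ψ p) • grad Ψ p) (gradPoloidal r₀ p))
        (f (Ψ p) • gradPoloidal r₀ p) = (deriv f (Ψ p) * f (Ψ p)) •
          cross3 (cross3 (grad Ψ p) (gradPoloidal r₀ p)) (gradPoloidal r₀ p) := by
      ext i
      fin_cases i <;> simp [cross3] <;> ring
    rw [this, cross3_cross3_right_self h0, smul_smul]
    congr 1
    ring
  refine ⟨hcross, ?_, ?_, hdiv, ?_⟩
  · intro p hp
    refine (hcross p hp).trans ?_
    rw [hden, dot3_gradPoloidal_self hp.1 hp.2]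
    have hρ := hp.2.ne'
    congr 1
    field_simp
  · intro p hp
    rw [hcross p hp, cross3_smul_self]
  · rintro ⟨p, ⟨hr, hρ⟩, hfp⟩ hzero
    let γ : ℝ → Fin 3 → ℝ := fun t => Function.update p 2 t
    have hγR (t : ℝ) : cylR (γ t) = cylR p := by simp [γ, cylR]
    have hγφ (t : ℝ) : cylφ (γ t) = cylφ p := by simp [γ, cylφ]
    have hγ2 (t : ℝ) : γ t 2 = t := by simp [γ]
    have hcont : Continuous fun t => f (Ψ (γ t)) := by
      simp only [hΨ, hγR, hγφ, hγ2]
      exact hf.continuous.comp (by fun_prop)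
    have hcontρ : Continuous fun t : ℝ => (cylR p - r₀) ^ 2 + t ^ 2 := by fun_prop
    have hp2 : γ (p 2) = p := Function.update_eq_self 2 p
    have h1 : ∀ᶠ t in nhds (p 2), f (Ψ (γ t)) ≠ 0 :=
      hcont.continuousAt.eventually_ne (by rwa [hp2])
    have h2 : ∀ᶠ t in nhds (p 2), 0 < (cylR p - r₀) ^ 2 + t ^ 2 :=
      hcontρ.continuousAt.eventually_const_lt hρ
    have h3 : ∀ᶠ t in nhdsWithin (p 2) {p 2}ᶜ, t ≠ 0 := by
      obtain h | h := eq_or_ne (p 2) 0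
      · rw [h]; exact self_mem_nhdsWithin
      · exact eventually_ne_nhdsWithin h
    obtain ⟨t, ⟨ht1, ht2⟩, ht3⟩ :=
      ((h1.and h2).filter_mono nhdsWithin_le_nhds |>.and h3).exists
    have hmem : 0 < cylR (γ t) ∧ 0 < (cylR (γ t) - r₀) ^ 2 + γ t 2 ^ 2 := by
      rw [hγR, hγ2]; exact ⟨hr, ht2⟩
    have h := (hdiv (γ t) hmem).symm.trans (hzero (γ t) hmem)
    rw [hden, hγ2] at h
    exact div_ne_zero (mul_ne_zero (neg_ne_zero.2 ht3) ht1)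
      (mul_pos hmem.1 (by simpa only [hγ2] using hmem.2)).ne' h
end

section
/- Let Ω ⊂ ℝ³ be open and let Ψ, Θ : Ω → ℝ be twice continuously differentiable. Set w = ∇Ψ×∇Θ. Then: (i) ∇·w = 0 on Ω; (ii) the scalar ∇Ψ·(∇×w) equals, up to sign, ∇·[∇Ψ×(∇Θ×∇Ψ)], so that ∇Ψ·∇×(∇Ψ×∇Θ) = 0 on Ω if and only if ∇·[∇Ψ×(∇Θ×∇Ψ)] = 0 on Ω; (iii) consequently, if Θ satisfies ∇·[∇Ψ×(∇Θ×∇Ψ)] = 0 on Ω, then w = ∇Ψ×∇Θ satisfies [(∇×w)×w]×∇Ψ = 0 and ∇·w = 0 on Ω. -/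
theorem div3_cross3 {u v : (Fin 3 → ℝ) → (Fin 3 → ℝ)} {x : Fin 3 → ℝ}
    (hu : DifferentiableAt ℝ u x) (hv : DifferentiableAt ℝ v x) :
    div3 (fun y => cross3 (u y) (v y)) x =
      dot3 (v x) (curl u x) - dot3 (u x) (curl v x) := by
  have hu' := differentiableAt_pi.1 hu
  have hv' := differentiableAt_pi.1 hv
  have key : ∀ i j k : Fin 3, pd i (fun y => u y j * v y k - u y k * v y j) x =
      u x j * pd i (fun y => v y k) x + v x k * pd i (fun y => u y j) x -
      (u x k * pd i (fun y => v y j) x + v x j * pd i (fun y => u y k) x) := by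
    intro i j k
    unfold pd
    rw [fderiv_fun_sub ((hu' j).fun_mul (hv' k)) ((hu' k).fun_mul (hv' j)),
      fderiv_fun_mul (hu' j) (hv' k), fderiv_fun_mul (hu' k) (hv' j)]
    simp
  simp only [div3, cross3, curl, dot3, Matrix.cons_val, key]
  ring

theorem grad_apply (f : (Fin 3 → ℝ) → ℝ) (x : Fin 3 → ℝ) (i : Fin 3) :
    grad f x i = pd i f x := by
  fin_cases i <;> rfl

theorem differentiableAt_fderiv_of_contDiffAt_two {f : (Fin 3 → ℝ) → ℝ} {x : Fin 3 → ℝ}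
    (hf : ContDiffAt ℝ 2 f x) : DifferentiableAt ℝ (fderiv ℝ f) x :=
  (hf.fderiv_right (m := 1) (by norm_num)).differentiableAt (by norm_num)

theorem differentiableAt_grad {f : (Fin 3 → ℝ) → ℝ} {x : Fin 3 → ℝ}
    (hf : ContDiffAt ℝ 2 f x) : DifferentiableAt ℝ (grad f) x := by
  refine differentiableAt_pi.2 fun i => ?_
  simp only [grad_apply]
  exact (differentiableAt_fderiv_of_contDiffAt_two hf).clm_apply
    (differentiableAt_const _)

/-- Symmetry of second partial derivatives. -/
theorem pd_pd_comm {f : (Fin 3 → ℝ) → ℝ} {x : Fin 3 → ℝ}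
    (hf : ContDiffAt ℝ 2 f x) (i j : Fin 3) :
    pd i (fun y => pd j f y) x = pd j (fun y => pd i f y) x := by
  have hd := differentiableAt_fderiv_of_contDiffAt_two hf
  have key : ∀ i j : Fin 3, pd i (fun y => pd j f y) x =
      fderiv ℝ (fderiv ℝ f) x (Pi.single i 1) (Pi.single j 1) := by
    intro i j
    unfold pd
    rw [fderiv_clm_apply hd (differentiableAt_const _)]
    simp
  rw [key, key]
  exact hf.isSymmSndFDerivAt (by simp) _ _

theorem curl_grad {f : (Fin 3 → ℝ) → ℝ} {x : Fin 3 → ℝ}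
    (hf : ContDiffAt ℝ 2 f x) : curl (grad f) x = 0 := by
  simp only [curl, grad_apply]
  rw [pd_pd_comm hf 1 2, pd_pd_comm hf 2 0, pd_pd_comm hf 0 1]
  simp

theorem DifferentiableAt.cross3 {u v : (Fin 3 → ℝ) → (Fin 3 → ℝ)} {x : Fin 3 → ℝ}
    (hu : DifferentiableAt ℝ u x) (hv : DifferentiableAt ℝ v x) :
    DifferentiableAt ℝ (fun y => cross3 (u y) (v y)) x := by
  have hu' := differentiableAt_pi.1 hu
  have hv' := differentiableAt_pi.1 hv
  refine differentiableAt_pi.2 fun i => ?_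
  fin_cases i <;>
    exact ((hu' _).fun_mul (hv' _)).fun_sub ((hu' _).fun_mul (hv' _))

theorem dot3_zero (u : Fin 3 → ℝ) : dot3 u 0 = 0 := by
  simp [dot3]

theorem cross3_cross3_comm (a b : Fin 3 → ℝ) :
    cross3 a (cross3 b a) = cross3 (cross3 a b) a := by
  ext i
  fin_cases i <;> simp [cross3] <;> ring

/-- Both `c` and `a × b` are orthogonal to `a`, so `c × (a × b)` is parallel to `a`. -/
theorem cross3_cross3_cross3_eq_zero {a c : Fin 3 → ℝ} (b : Fin 3 → ℝ) (h : dot3 a c = 0) :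
    cross3 (cross3 c (cross3 a b)) a = 0 := by
  have key : cross3 (cross3 c (cross3 a b)) a = dot3 a c • cross3 a b := by
    ext i
    fin_cases i <;> simp [cross3, dot3] <;> ring
  rw [key, h, zero_smul]

/-- for `w = ∇Ψ×∇Θ` one has (i) `∇·w = 0`; (ii) `∇Ψ·(∇×w)` coincides (up to sign)
with `∇·[∇Ψ×(∇Θ×∇Ψ)]`, so one vanishes on `Ω` iff the other does; (iii) if
`∇·[∇Ψ×(∇Θ×∇Ψ)] = 0` on `Ω`, then `w` solves `[(∇×w)×w]×∇Ψ = 0`, `∇·w = 0` on `Ω`. -/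
theorem clebsch_reduction
    (Ω : Set (Fin 3 → ℝ)) (hΩ : IsOpen Ω)
    (Ψ Θ : (Fin 3 → ℝ) → ℝ)
    (hΨ : ContDiffOn ℝ 2 Ψ Ω) (hΘ : ContDiffOn ℝ 2 Θ Ω)
    (w : (Fin 3 → ℝ) → (Fin 3 → ℝ))
    (hw : ∀ x, w x = cross3 (grad Ψ x) (grad Θ x)) :
    (∀ x ∈ Ω, div3 w x = 0) ∧
    (∀ x ∈ Ω, dot3 (grad Ψ x) (curl w x) =
      div3 (fun y => cross3 (grad Ψ y) (cross3 (grad Θ y) (grad Ψ y))) x) ∧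
    ((∀ x ∈ Ω, dot3 (grad Ψ x) (curl w x) = 0) ↔
      (∀ x ∈ Ω, div3 (fun y => cross3 (grad Ψ y) (cross3 (grad Θ y) (grad Ψ y))) x = 0)) ∧
    ((∀ x ∈ Ω, div3 (fun y => cross3 (grad Ψ y) (cross3 (grad Θ y) (grad Ψ y))) x = 0) →
      (∀ x ∈ Ω, cross3 (cross3 (curl w x) (w x)) (grad Ψ x) = 0) ∧
      (∀ x ∈ Ω, div3 w x = 0)) := by
  obtain rfl : w = fun x => cross3 (grad Ψ x) (grad Θ x) := funext hw
  have cΨ : ∀ x ∈ Ω, ContDiffAt ℝ 2 Ψ x := fun x hx => hΨ.contDiffAt (hΩ.mem_nhds hx)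
  have cΘ : ∀ x ∈ Ω, ContDiffAt ℝ 2 Θ x := fun x hx => hΘ.contDiffAt (hΩ.mem_nhds hx)
  have hdiv : ∀ x ∈ Ω, div3 (fun x => cross3 (grad Ψ x) (grad Θ x)) x = 0 := by
    intro x hx
    rw [div3_cross3 (differentiableAt_grad (cΨ x hx)) (differentiableAt_grad (cΘ x hx)),
      curl_grad (cΨ x hx), curl_grad (cΘ x hx), dot3_zero, dot3_zero, sub_zero]
  have hcurl : ∀ x ∈ Ω,
      dot3 (grad Ψ x) (curl (fun x => cross3 (grad Ψ x) (grad Θ x)) x) =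
      div3 (fun y => cross3 (grad Ψ y) (cross3 (grad Θ y) (grad Ψ y))) x := by
    intro x hx
    have dΨ := differentiableAt_grad (cΨ x hx)
    simp only [cross3_cross3_comm]
    rw [div3_cross3 (dΨ.cross3 (differentiableAt_grad (cΘ x hx))) dΨ,
      curl_grad (cΨ x hx), dot3_zero, sub_zero]
  refine ⟨hdiv, hcurl, forall₂_congr fun x hx => by rw [hcurl x hx], fun h => ⟨?_, hdiv⟩⟩
  intro x hx
  exact cross3_cross3_cross3_eq_zero _ ((hcurl x hx).trans (h x hx))
end

section
/- Fix r₀ > 0 and ε > 0. On the open set Ω₀ = {(x,y,z) ∈ ℝ³ : r > 0}, let Ψ_ε = (1/2)[(r e^{−εy} − r₀)² + z²], ξ_ε = ∇φ + ε e_x, and w = f(Ψ_ε) ξ_ε with f² = exp(Ψ_ε), so that |w|² = exp(Ψ_ε) · ((1−εy)² + ε²x²)/r². If constant vectors a, b ∈ ℝ³ satisfy (a + b×x)·∇(|w|²)(x) = 0 for every x ∈ Ω₀, then a = b = 0. Consequently the vector field w is not invariant under any nontrivial continuous Euclidean isometry. -/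
theorem dot3_grad (f : (Fin 3 → ℝ) → ℝ) (p v : Fin 3 → ℝ) :
    dot3 v (grad f p) = fderiv ℝ f p v := by
  have hv : v = v 0 • Pi.single 0 1 + v 1 • Pi.single 1 1 + v 2 • Pi.single 2 1 := by
    ext i
    fin_cases i <;> simp
  conv_rhs => rw [hv]
  simp [dot3, grad, pd]

/-- The squared modulus of the field `w`, in Cartesian coordinates. -/
noncomputable def sqModulus (r₀ ε : ℝ) (q : Fin 3 → ℝ) : ℝ :=
  Real.exp ((1/2) * ((Real.sqrt (q 0 ^ 2 + q 1 ^ 2) * Real.exp (-ε * q 1) - r₀) ^ 2 + q 2 ^ 2)) *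
    ((-(q 1) / (q 0 ^ 2 + q 1 ^ 2) + ε) ^ 2 + (q 0 / (q 0 ^ 2 + q 1 ^ 2)) ^ 2)

theorem differentiableAt_sqModulus (r₀ ε : ℝ) {p : Fin 3 → ℝ} (hp : p 0 ^ 2 + p 1 ^ 2 ≠ 0) :
    DifferentiableAt ℝ (sqModulus r₀ ε) p := by
  unfold sqModulus
  fun_prop (disch := assumption)

/-- The derivative of the squared modulus in the direction `v`, at a point of the plane `y = 0`. -/
theorem fderiv_sqModulus (r₀ ε z : ℝ) {x : ℝ} (hx : x ≠ 0) (v : Fin 3 → ℝ) :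
    fderiv ℝ (sqModulus r₀ ε) ![x, 0, z] v =
      Real.exp ((1/2) * ((|x| - r₀) ^ 2 + z ^ 2)) *
        (v 0 * ((|x| - r₀) * (x / |x|) * (ε ^ 2 + 1 / x ^ 2) - 2 / x ^ 3) -
          v 1 * ε * (|x| * (|x| - r₀) * (ε ^ 2 + 1 / x ^ 2) + 2 / x ^ 2) +
          v 2 * z * (ε ^ 2 + 1 / x ^ 2)) := by
  have hd : DifferentiableAt ℝ (sqModulus r₀ ε) ![x, 0, z] :=
    differentiableAt_sqModulus r₀ ε (by simpa using hx)
  rw [← hd.lineDeriv_eq_fderiv, lineDeriv]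
  have h0 : HasDerivAt (fun t : ℝ => x + t * v 0) (v 0) 0 := by
    simpa using ((hasDerivAt_id (0 : ℝ)).mul_const (v 0)).const_add x
  have h1 : HasDerivAt (fun t : ℝ => t * v 1) (v 1) 0 := by
    simpa using (hasDerivAt_id (0 : ℝ)).mul_const (v 1)
  have h2 : HasDerivAt (fun t : ℝ => z + t * v 2) (v 2) 0 := by
    simpa using ((hasDerivAt_id (0 : ℝ)).mul_const (v 2)).const_add z
  have hR := (h0.pow 2).add (h1.pow 2)
  have hR0 : (x + 0 * v 0) ^ 2 + (0 * v 1) ^ 2 ≠ 0 := by simpa using hx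
  have hS := ((hR.sqrt hR0).mul ((h1.const_mul (-ε)).exp)).sub_const r₀
  have hE := (((hS.pow 2).add (h2.pow 2)).const_mul (1/2)).exp
  have hG := (((h1.neg.div hR hR0).add_const ε).pow 2).add ((h0.div hR hR0).pow 2)
  have hF := hE.mul hG
  refine HasDerivAt.deriv ((hF.congr_of_eventuallyEq (.of_forall fun t => ?_)).congr_deriv ?_)
  · simp [sqModulus]
  simp [Real.sqrt_sq_eq_abs]
  field_simp
  ring_nf

/-- with `Ψ_ε = (1/2)[(r e^{−εy} − r₀)² + z²]`, `ξ_ε = ∇φ + ε e_x`, and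
`w = f(Ψ_ε) ξ_ε` where `f² = exp(Ψ_ε)` (so `|w|² = e^{Ψ_ε}((1−εy)² + ε²x²)/r²`), if
`(a + b×x)·∇|w|² = 0` on `{r > 0}` then `a = b = 0`: the field `w` is not invariant under any
nontrivial continuous Euclidean isometry. -/
theorem asymmetric_field_modulus_no_isometry
    (r₀ ε : ℝ) (hr₀ : 0 < r₀) (hε : 0 < ε)
    (Ψ : (Fin 3 → ℝ) → ℝ)
    (hΨ : ∀ p : Fin 3 → ℝ, Ψ p =
      (1/2) * ((cylR p * Real.exp (-ε * p 1) - r₀) ^ 2 + p 2 ^ 2))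
    (ξ : (Fin 3 → ℝ) → (Fin 3 → ℝ))
    (hξ : ∀ p : Fin 3 → ℝ, ξ p =
      ![-(p 1) / (p 0 ^ 2 + p 1 ^ 2) + ε, p 0 / (p 0 ^ 2 + p 1 ^ 2), 0])
    (w : (Fin 3 → ℝ) → (Fin 3 → ℝ))
    (hw : ∀ p : Fin 3 → ℝ, w p = Real.exp (Ψ p / 2) • ξ p)
    (a b : Fin 3 → ℝ)
    (h : ∀ p : Fin 3 → ℝ, 0 < cylR p →
      dot3 (a + cross3 b p) (grad (fun q => dot3 (w q) (w q)) p) = 0) :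
    a = 0 ∧ b = 0 := by
  have hFun : (fun q => dot3 (w q) (w q)) = sqModulus r₀ ε := by
    funext q
    have he : Real.exp (Ψ q) = Real.exp (Ψ q / 2) * Real.exp (Ψ q / 2) := by
      rw [← Real.exp_add, add_halves]
    rw [sqModulus, ← cylR, ← hΨ, he, hw, hξ]
    simp [dot3]
    ring
  have key (x z : ℝ) (hx : x ≠ 0) :
      (a 0 + b 1 * z) * ((|x| - r₀) * (x / |x|) * (ε ^ 2 + 1 / x ^ 2) - 2 / x ^ 3) -
        (a 1 + b 2 * x - b 0 * z) * ε * (|x| * (|x| - r₀) * (ε ^ 2 + 1 / x ^ 2) + 2 / x ^ 2) +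
        (a 2 - b 1 * x) * z * (ε ^ 2 + 1 / x ^ 2) = 0 := by
    have hp := h ![x, 0, z] (by simpa [cylR] using Real.sqrt_pos.mpr (by positivity))
    rw [hFun, dot3_grad, fderiv_sqModulus r₀ ε z hx] at hp
    have := (mul_eq_zero.mp hp).resolve_left (Real.exp_ne_zero _)
    simp [cross3] at this
    rw [← this]
    ring
  have even_odd (x : ℝ) (hx : 0 < x) :
      a 1 * (x * (x - r₀) * (ε ^ 2 + 1 / x ^ 2) + 2 / x ^ 2) = 0 ∧
      a 0 * ((x - r₀) * (ε ^ 2 + 1 / x ^ 2) - 2 / x ^ 3) =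
        b 2 * x * ε * (x * (x - r₀) * (ε ^ 2 + 1 / x ^ 2) + 2 / x ^ 2) ∧
      b 1 * (r₀ * (ε ^ 2 + 1 / x ^ 2) + 2 / x ^ 3) = 0 ∧
      b 0 * ε * (x * (x - r₀) + 2 / (ε ^ 2 * x ^ 2 + 1)) = - a 2 := by
    have k₁ := key x 0 hx.ne'
    have k₂ := key (-x) 0 (neg_ne_zero.mpr hx.ne')
    have k₃ := key x 1 hx.ne'
    have k₄ := key (-x) 1 (neg_ne_zero.mpr hx.ne')
    have h3 : (-x) ^ 3 = -x ^ 3 := by ring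
    rw [abs_of_pos hx, div_self hx.ne'] at k₁ k₃
    rw [abs_neg, abs_of_pos hx, neg_div, div_self hx.ne', neg_sq, h3, div_neg] at k₂ k₄
    refine ⟨?_, ?_, ?_, ?_⟩
    · refine (mul_eq_zero.mp ?_).resolve_left hε.ne'
      linear_combination (-1 / 2) * k₁ - 1 / 2 * k₂
    · linear_combination (1 / 2) * k₁ - 1 / 2 * k₂
    · linear_combination (-1 / 2) * (k₃ - k₁) + 1 / 2 * (k₄ - k₂)
    · have hB : b 0 * ε * (x * (x - r₀) * (ε ^ 2 + 1 / x ^ 2) + 2 / x ^ 2) +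
          a 2 * (ε ^ 2 + 1 / x ^ 2) = 0 := by
        linear_combination (1 / 2) * (k₃ - k₁) + 1 / 2 * (k₄ - k₂)
      have hN : ε ^ 2 * x ^ 2 + 1 ≠ 0 := by positivity
      field_simp at hB ⊢
      linear_combination hB
  obtain ⟨e₁, e₂, e₃, e₄⟩ := even_odd r₀ hr₀
  have hM : 0 < r₀ + 2 / r₀ := by positivity
  obtain ⟨-, o₂, -, o₄⟩ := even_odd (r₀ + 2 / r₀) hM
  have hMr : (r₀ + 2 / r₀) * (r₀ + 2 / r₀ - r₀) = 2 + 4 / r₀ ^ 2 := by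
    field_simp
    ring
  have ha1 : a 1 = 0 := by
    refine (mul_eq_zero.mp e₁).resolve_right ?_
    rw [sub_self, mul_zero, zero_mul, zero_add]
    positivity
  have hb1 : b 1 = 0 := (mul_eq_zero.mp e₃).resolve_right (by positivity)
  have hb0 : b 0 = 0 := by
    rw [hMr, ← e₄] at o₄
    have hlt : 2 / (ε ^ 2 * r₀ ^ 2 + 1) < 2 :=
      div_lt_self two_pos (lt_add_of_pos_left 1 (by positivity))
    have hpos : 0 < 4 / r₀ ^ 2 + 2 / (ε ^ 2 * (r₀ + 2 / r₀) ^ 2 + 1) := by positivity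
    have hne : ε * (2 + 4 / r₀ ^ 2 + 2 / (ε ^ 2 * (r₀ + 2 / r₀) ^ 2 + 1) -
        2 / (ε ^ 2 * r₀ ^ 2 + 1)) ≠ 0 :=
      mul_ne_zero hε.ne' (by linarith)
    exact (mul_eq_zero.mp (by linear_combination o₄)).resolve_right hne
  have ha2 : a 2 = 0 := by simpa [hb0] using e₄
  have ha0 : a 0 = -(ε * r₀ ^ 2 * b 2) := by
    rw [sub_self] at e₂
    field_simp at e₂
    linarith
  have hb2 : b 2 = 0 := by
    set M := r₀ + 2 / r₀ with hM_def
    have hgt : r₀ < M := lt_add_of_pos_right r₀ (by positivity)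
    have hne : ε * ((r₀ ^ 2 * (M - r₀) + M ^ 2 * (M - r₀)) * (ε ^ 2 + 1 / M ^ 2) +
        2 * (M ^ 2 - r₀ ^ 2) / M ^ 3) ≠ 0 := by
      have h₁ : 0 < M - r₀ := sub_pos.mpr hgt
      have h₂ : 0 < M ^ 2 - r₀ ^ 2 := sub_pos.mpr (by gcongr)
      positivity
    refine (mul_eq_zero.mp ?_).resolve_right hne
    rw [ha0] at o₂
    field_simp at o₂ ⊢
    linear_combination (-ε) * o₂
  rw [hb2, mul_zero, neg_zero] at ha0
  constructor
  · ext i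
    fin_cases i <;> assumption
  · ext i
    fin_cases i <;> assumption
end
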